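/- Let v = (v₁, v₂, v₃) ∈ ℤ³ have pairwise distinct positive coordinates with gcd(v₁, v₂, v₃) = 1, suppose gcd(v₁, v₂) = ℓ > 1, and let s = (s₁, s₂, s₃) ∈ ℝ³ be any triple of starting points. Then there exists t ∈ ℝ such that 1/4 < {s_j + v_j·t} < 3/4 for every j ∈ {1,2,3}. -/

import Mathlib

/-- `x` is at distance strictly greater than `1/4` from every integer. -/
def FarFromInt (x : ℝ) : Prop := ∃ n : ℤ, (n : ℝ) + 1 / 4 < x ∧ x < n + 3 / 4

theorem FarFromInt.fract {x : ℝ} (h : FarFromInt x) :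
    (1 : ℝ) / 4 < Int.fract x ∧ Int.fract x < 3 / 4 := by
  obtain ⟨n, h1, h2⟩ := h
  have hn : ⌊x⌋ = n := Int.floor_eq_iff.2 ⟨by linarith, by linarith⟩
  rw [Int.fract, hn]
  constructor <;> linarith

theorem FarFromInt.add_int {x : ℝ} (h : FarFromInt x) (k : ℤ) : FarFromInt (x + k) := by
  obtain ⟨n, h1, h2⟩ := h
  refine ⟨n + k, ?_, ?_⟩ <;> push_cast <;> linarith

theorem isOpen_farFromInt : IsOpen {x : ℝ | FarFromInt x} := by
  have : {x : ℝ | FarFromInt x} = ⋃ n : ℤ, Set.Ioo ((n : ℝ) + 1 / 4) (n + 3 / 4) := by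
    ext x
    simp [FarFromInt]
  rw [this]
  exact isOpen_iUnion fun n => isOpen_Ioo

theorem isOpen_farFromInt_affine (s v : ℝ) : IsOpen {t : ℝ | FarFromInt (s + v * t)} :=
  isOpen_farFromInt.preimage (f := fun t : ℝ => s + v * t) (by fun_prop)

theorem exists_farFromInt_add_div {m : ℤ} (hm : 2 ≤ m) {x : ℝ}
    (hx : ∀ n : ℤ, (m : ℝ) * (x - 1 / 4) ≠ n) : ∃ j : ℤ, FarFromInt (x + j / m) := by
  have hmR : (2 : ℝ) ≤ m := by exact_mod_cast hm
  have h1 := Int.floor_le ((m : ℝ) * (x - 1 / 4))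
  have h2 := Int.lt_floor_add_one ((m : ℝ) * (x - 1 / 4))
  have h3 := lt_of_le_of_ne h1 (hx _).symm
  refine ⟨-⌊(m : ℝ) * (x - 1 / 4)⌋, 0, ?_⟩
  generalize ⌊(m : ℝ) * (x - 1 / 4)⌋ = f at *
  have hxe : x + ((-f : ℤ) : ℝ) / m = 1 / 4 + (m * (x - 1 / 4) - f) / m := by
    push_cast
    field_simp
    ring
  rw [hxe]
  have h4 : 0 < ((m : ℝ) * (x - 1 / 4) - f) / m := div_pos (by linarith) (by linarith)
  have h5 : ((m : ℝ) * (x - 1 / 4) - f) / m < 1 / 2 := by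
    rw [div_lt_iff₀ (by linarith)]
    linarith
  push_cast
  constructor <;> linarith

theorem exists_mem_isOpen_mul_ne_int {U : Set ℝ} (hU : IsOpen U) (hne : U.Nonempty) (b : ℝ)
    {c : ℝ} (hc : 0 < c) : ∃ t ∈ U, ∀ n : ℤ, b + c * t ≠ n := by
  obtain ⟨t₀, ht₀⟩ := hne
  by_cases h : ∀ n : ℤ, b + c * t₀ ≠ n
  · exact ⟨t₀, ht₀, h⟩
  push Not at h
  obtain ⟨n₀, hn₀⟩ := h
  obtain ⟨ε, hε, hball⟩ := Metric.isOpen_iff.1 hU t₀ ht₀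
  have hδ : 0 < min (ε / 2) (1 / (2 * c)) := by positivity
  have hδ1 := min_le_left (ε / 2) (1 / (2 * c))
  have hδ2 := min_le_right (ε / 2) (1 / (2 * c))
  generalize min (ε / 2) (1 / (2 * c)) = δ at *
  refine ⟨t₀ + δ, hball ?_, fun n hn => ?_⟩
  · rw [Metric.mem_ball, Real.dist_eq, add_sub_cancel_left, abs_of_pos hδ]
    linarith
  · have h1 : 0 < c * δ := by positivity
    have h2 : c * δ ≤ 1 / 2 := by
      calc c * δ ≤ c * (1 / (2 * c)) := by gcongr
        _ = 1 / 2 := by field_simp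
    have h3 : (n : ℝ) = n₀ + c * δ := by rw [← hn, ← hn₀]; ring
    have h4 : n₀ < n := by exact_mod_cast (by linarith : (n₀ : ℝ) < n)
    have h5 : n < n₀ + 1 := by exact_mod_cast (by linarith : (n : ℝ) < n₀ + 1)
    omega

/-- A nonempty open `1/m`-periodic set of times contains a time at which a runner of
speed coprime to `m` is far from the integers. -/
theorem exists_mem_farFromInt_of_periodic {U : Set ℝ} (hU : IsOpen U) (hne : U.Nonempty)
    {m v : ℤ} (hm : 2 ≤ m) (hv : 0 < v) (hvm : IsCoprime v m)
    (hper : ∀ t ∈ U, ∀ k : ℤ, t + k / m ∈ U) (s : ℝ) :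
    ∃ t ∈ U, FarFromInt (s + v * t) := by
  have hmR : (0 : ℝ) < m := by exact_mod_cast (by omega : 0 < m)
  have hvR : (0 : ℝ) < v := by exact_mod_cast hv
  obtain ⟨t, ht, hn⟩ :=
    exists_mem_isOpen_mul_ne_int hU hne ((m : ℝ) * (s - 1 / 4)) (mul_pos hmR hvR)
  obtain ⟨j, hj⟩ := exists_farFromInt_add_div hm (x := s + v * t) fun n h =>
    hn n (by rw [← h]; ring)
  obtain ⟨a, b, hab⟩ := hvm
  have habR : (a : ℝ) * v + b * m = 1 := by exact_mod_cast hab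
  refine ⟨t + ((j * a : ℤ) : ℝ) / m, hper t ht _, ?_⟩
  convert hj.add_int (-(j * b)) using 1
  push_cast
  field_simp
  linear_combination (j : ℝ) * habR

theorem farFromInt_add_mul_div {s t : ℝ} {v m : ℤ} (hm : m ≠ 0) (hmv : m ∣ v)
    (h : FarFromInt (s + v * t)) (k : ℤ) : FarFromInt (s + v * (t + k / m)) := by
  obtain ⟨c, rfl⟩ := hmv
  have hmR : (m : ℝ) ≠ 0 := by exact_mod_cast hm
  convert h.add_int (c * k) using 1
  push_cast
  field_simp
  ring

theorem exists_farFromInt_of_coprime_of_two_le {p q : ℤ} (hp : 0 < p) (hq : 2 ≤ q)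
    (hpq : IsCoprime p q) (s s' : ℝ) :
    ∃ t : ℝ, FarFromInt (s + p * t) ∧ FarFromInt (s' + q * t) := by
  have hqR : (q : ℝ) ≠ 0 := by exact_mod_cast (by omega : q ≠ 0)
  obtain ⟨t, ht, h⟩ := exists_mem_farFromInt_of_periodic (isOpen_farFromInt_affine s' q)
    ⟨(1 / 2 - s') / q, 0, by field_simp; norm_num, by field_simp; norm_num⟩ hq hp hpq
    (fun t ht k => farFromInt_add_mul_div (by omega) dvd_rfl ht k) s
  exact ⟨t, h, ht⟩

theorem exists_farFromInt_of_coprime_of_ne {p q : ℤ} (hp : 0 < p) (hq : 0 < q) (hne : p ≠ q)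
    (hpq : IsCoprime p q) (s s' : ℝ) :
    ∃ t : ℝ, FarFromInt (s + p * t) ∧ FarFromInt (s' + q * t) := by
  by_cases h : 2 ≤ q
  · exact exists_farFromInt_of_coprime_of_two_le hp h hpq s s'
  · obtain ⟨t, h1, h2⟩ :=
      exists_farFromInt_of_coprime_of_two_le hq (by omega : 2 ≤ p) hpq.symm s' s
    exact ⟨t, h2, h1⟩

theorem stmt9 (v : Fin 3 → ℤ) (hpos : ∀ j, 0 < v j)
    (hinj : Function.Injective v)
    (hgcd : Finset.univ.gcd v = 1)
    (ℓ : ℤ) (hℓ : ℓ = gcd (v 0) (v 1)) (hℓ1 : 1 < ℓ)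
    (s : Fin 3 → ℝ) :
    ∃ t : ℝ, ∀ j, (1 : ℝ) / 4 < Int.fract (s j + (v j : ℝ) * t) ∧
      Int.fract (s j + (v j : ℝ) * t) < 3 / 4 := by
  have hℓ0 : (ℓ : ℝ) ≠ 0 := by exact_mod_cast (by omega : ℓ ≠ 0)
  have hd0 : ℓ ∣ v 0 := hℓ ▸ gcd_dvd_left _ _
  have hd1 : ℓ ∣ v 1 := hℓ ▸ gcd_dvd_right _ _
  have hcop : IsCoprime (v 2) ℓ := by
    rw [← gcd_isUnit_iff]
    refine isUnit_of_dvd_one ?_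
    rw [← hgcd]
    refine Finset.dvd_gcd fun j _ => ?_
    fin_cases j
    · exact (gcd_dvd_right _ _).trans hd0
    · exact (gcd_dvd_right _ _).trans hd1
    · exact gcd_dvd_left _ _
  obtain ⟨p, hp⟩ := id hd0
  obtain ⟨q, hq⟩ := id hd1
  have hp0 : 0 < p := pos_of_mul_pos_right (hp ▸ hpos 0) (by omega)
  have hq0 : 0 < q := pos_of_mul_pos_right (hq ▸ hpos 1) (by omega)
  have hne : p ≠ q := by
    rintro rfl
    exact absurd (hinj (hp.trans hq.symm)) (by decide)
  have hpq : IsCoprime p q := by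
    rw [← gcd_isUnit_iff]
    refine isUnit_of_dvd_one ((mul_dvd_mul_iff_left (by omega : ℓ ≠ 0)).1 ?_)
    rw [mul_one]
    conv_rhs => rw [hℓ]
    refine dvd_gcd ?_ ?_
    · rw [hp]; exact mul_dvd_mul_left _ (gcd_dvd_left _ _)
    · rw [hq]; exact mul_dvd_mul_left _ (gcd_dvd_right _ _)
  obtain ⟨τ, h0, h1⟩ := exists_farFromInt_of_coprime_of_ne hp0 hq0 hne hpq (s 0) (s 1)
  obtain ⟨t, ⟨ht0, ht1⟩, ht2⟩ := exists_mem_farFromInt_of_periodic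
    ((isOpen_farFromInt_affine (s 0) (v 0)).inter (isOpen_farFromInt_affine (s 1) (v 1)))
    ⟨τ / ℓ, by
      simp only [Set.mem_inter_iff, Set.mem_ofPred_eq]
      constructor
      · convert h0 using 2
        rw [hp]; push_cast; field_simp
      · convert h1 using 2
        rw [hq]; push_cast; field_simp⟩
    (by omega : 2 ≤ ℓ) (hpos 2) hcop
    (fun t ht k => ⟨farFromInt_add_mul_div (by omega) hd0 ht.1 k,
      farFromInt_add_mul_div (by omega) hd1 ht.2 k⟩) (s 2)
  refine ⟨t, fun j => FarFromInt.fract ?_⟩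
  fin_cases j
  · exact ht0
  · exact ht1
  · exact ht2
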